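/- Let λ > 1, μ > 0 and ν > 0 satisfy μϱ(λ) ≤ ν. Then every maximizer ω ∈ Σ_{μ,ν,λ} satisfies the Euler–Lagrange relation ω = λ(𝒢ω − W x₂ − γ)₊ almost everywhere in Π for some constants W ≥ 0 and γ ≥ 0, and these constants are uniquely determined by ω. -/

import Mathlib

open MeasureTheory Real Filter

noncomputable section

/-- The upper half plane `Π = {x ∈ ℝ² : x₂ > 0}`. -/
def UHP : Set (ℝ × ℝ) := {x | 0 < x.2}

/-- Euclidean norm of a point of `ℝ²`. -/
def rad (x : ℝ × ℝ) : ℝ := Real.sqrt (x.1 ^ 2 + x.2 ^ 2)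

/-- Modified Bessel function of the second kind of order `0`:
`K₀(r) = ∫₀^∞ exp(-r cosh t) dt`. -/
def K0 (r : ℝ) : ℝ := ∫ t in Set.Ioi (0 : ℝ), Real.exp (-(r * Real.cosh t))

/-- Fundamental solution `G(x,y) = (1/2π) K₀(|x-y|)` of `−Δ + Id` on `ℝ²`. -/
def Gker (x y : ℝ × ℝ) : ℝ := (1 / (2 * Real.pi)) * K0 (rad (x - y))

/-- Reflection `x̄ = (x₁, −x₂)` across the `x₁`-axis. -/
def reflPt (x : ℝ × ℝ) : ℝ × ℝ := (x.1, -x.2)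

/-- Green's function `G_Π(x,y) = G(x,y) − G(x̄,y)` of `−Δ + Id` on the half plane. -/
def GUHP (x y : ℝ × ℝ) : ℝ := Gker x y - Gker (reflPt x) y

/-- The operator `𝒢ω(x) = ∫_Π G_Π(x,y) ω(y) dy`. -/
def Gop (ω : ℝ × ℝ → ℝ) (x : ℝ × ℝ) : ℝ := ∫ y in UHP, GUHP x y * ω y

/-- Kinetic energy `E(ω) = (1/2) ∫_Π ω 𝒢ω`. -/
def kineticE (ω : ℝ × ℝ → ℝ) : ℝ := (1 / 2) * ∫ x in UHP, ω x * Gop ω x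

/-- Impulse `I(ω) = ∫_Π x₂ ω dx`. -/
def impulse (ω : ℝ × ℝ → ℝ) : ℝ := ∫ x in UHP, x.2 * ω x

/-- `L¹(Π)` norm. -/
def normL1 (f : ℝ × ℝ → ℝ) : ℝ := ∫ x in UHP, |f x|

/-- `L²(Π)` norm. -/
def normL2 (f : ℝ × ℝ → ℝ) : ℝ := (∫ x in UHP, (f x) ^ 2) ^ ((1 : ℝ) / 2)

/-- `L^s(Π)` norm. -/
def normLs (s : ℝ) (f : ℝ × ℝ → ℝ) : ℝ := (∫ x in UHP, |f x| ^ s) ^ (1 / s)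

/-- Nonnegative member of `L¹(Π) ∩ L²(Π)`. -/
def NonnegL1L2 (ω : ℝ × ℝ → ℝ) : Prop :=
  (∀ x ∈ UHP, 0 ≤ ω x) ∧ IntegrableOn ω UHP ∧ IntegrableOn (fun x => (ω x) ^ 2) UHP

/-- Steiner symmetry in the `x₁` variable. -/
def SteinerSym (f : ℝ × ℝ → ℝ) : Prop :=
  (∀ x : ℝ × ℝ, f (-x.1, x.2) = f x) ∧
  ∀ x₂ : ℝ, 0 < x₂ → AntitoneOn (fun x₁ => f (x₁, x₂)) (Set.Ioi (0 : ℝ))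

/-- The admissible class `𝒜_{μ,ν}`. -/
def InAdm (μ ν : ℝ) (ω : ℝ × ℝ → ℝ) : Prop :=
  (∀ x ∈ UHP, 0 ≤ ω x) ∧ IntegrableOn ω UHP ∧ IntegrableOn (fun x => (ω x) ^ 2) UHP ∧
  IntegrableOn (fun x => x.2 * ω x) UHP ∧
  impulse ω = μ ∧ (∫ x in UHP, ω x) ≤ ν

/-- The energy functional `ℰ_λ(ω) = E(ω) − (1/(2λ)) ∫_Π ω²`. -/
def Efun (lam : ℝ) (ω : ℝ × ℝ → ℝ) : ℝ :=
  kineticE ω - (1 / (2 * lam)) * ∫ x in UHP, (ω x) ^ 2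

/-- The supremum `S_{μ,ν,λ} = sup_{ω ∈ 𝒜_{μ,ν}} ℰ_λ(ω)`. -/
def Sval (lam μ ν : ℝ) : ℝ := sSup {s | ∃ ω, InAdm μ ν ω ∧ s = Efun lam ω}

/-- `ω` is a maximizer, i.e. `ω ∈ Σ_{μ,ν,λ}`. -/
def IsMaximizer (lam μ ν : ℝ) (ω : ℝ × ℝ → ℝ) : Prop :=
  InAdm μ ν ω ∧ Efun lam ω = Sval lam μ ν

/-- Bessel function of the first kind of order one. -/
def J1 (r : ℝ) : ℝ :=
  ∑' k : ℕ, ((-1 : ℝ) ^ k / ((Nat.factorial k : ℝ) * (Nat.factorial (k + 1) : ℝ))) *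
    (r / 2) ^ (2 * k + 1)

/-- Modified Bessel function of the second kind of order one. -/
def K1 (r : ℝ) : ℝ := ∫ t in Set.Ioi (0 : ℝ), Real.exp (-(r * Real.cosh t)) * Real.cosh t

/-- The set of `t > 0` with `J₁(√(λ−1) t) ≠ 0` solving the transcendental equation
`t (K₁'(t)/K₁(t) + (λ−1)^{-1/2} J₁'(√(λ−1)t)/J₁(√(λ−1)t)) = λ/(λ−1)`. -/
def aSet (lam : ℝ) : Set ℝ :=
  {t | 0 < t ∧ J1 (Real.sqrt (lam - 1) * t) ≠ 0 ∧
    t * (deriv K1 t / K1 t +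
      (1 / Real.sqrt (lam - 1)) *
        (deriv J1 (Real.sqrt (lam - 1) * t) / J1 (Real.sqrt (lam - 1) * t))) = lam / (lam - 1)}

/-- The smallest positive solution `a = a(λ)`. -/
def aLam (lam : ℝ) : ℝ := sInf (aSet lam)

/-- The stream function `Ψ_L^{λ,W}` of the Lamb dipole, written in polar coordinates
`x₁ = r cos θ`, `x₂ = r sin θ` (so that `sin θ = x₂ / r`). -/
def PsiL (lam W : ℝ) (x : ℝ × ℝ) : ℝ :=
  if rad x ≤ aLam lam then
    ((-(W * aLam lam / (lam - 1)) / J1 (Real.sqrt (lam - 1) * aLam lam)) *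
        J1 (Real.sqrt (lam - 1) * rad x) + (W * lam / (lam - 1)) * rad x) * (x.2 / rad x)
  else (W * aLam lam / K1 (aLam lam)) * K1 (rad x) * (x.2 / rad x)

/-- The Lamb dipole `ω_L^{λ,W} = λ (Ψ_L^{λ,W} − W x₂)₊` restricted to `Π`. -/
def omegaL (lam W : ℝ) (x : ℝ × ℝ) : ℝ :=
  if 0 < x.2 then lam * max (PsiL lam W x - W * x.2) 0 else 0

/-- `ϱ(λ) = (∫_Π ω_L^{λ,1} dx) / I(ω_L^{λ,1})`. -/
def varrho (lam : ℝ) : ℝ := (∫ x in UHP, omegaL lam 1 x) / impulse (omegaL lam 1)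

/-- The Laplacian on `ℝ²`, written coordinatewise. -/
def lap (ψ : ℝ × ℝ → ℝ) (x : ℝ × ℝ) : ℝ :=
  deriv (deriv fun t => ψ (t, x.2)) x.1 + deriv (deriv fun t => ψ (x.1, t)) x.2

/-- Distance (in `L¹ ∩ L²` plus weighted `L¹`) from `ζ` to a set of functions `S`. -/
def distToSet (S : Set ((ℝ × ℝ) → ℝ)) (ζ : (ℝ × ℝ) → ℝ) : ℝ :=
  sInf {d | ∃ ω ∈ S, d = normL1 (fun x => ζ x - ω x) + normL2 (fun x => ζ x - ω x) +
    normL1 (fun x => x.2 * (ζ x - ω x))}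

end


open scoped Topology

/-- Lagrange multiplier lemma in `ℝ³`. -/
lemma aux_multiplier (T : Set (ℝ × ℝ × ℝ))
    (hadd : ∀ p ∈ T, ∀ q ∈ T, p + q ∈ T)
    (hsmul : ∀ p ∈ T, ∀ s : ℝ, 0 < s → s • p ∈ T)
    (hnn : ∀ p ∈ T, 0 ≤ p.2.1) (l0 μ ν : ℝ) (hμ : 0 < μ)
    (hmax : ∀ p ∈ T, p.2.1 = μ → p.2.2 < ν → p.1 ≤ l0)
    (q : ℝ × ℝ × ℝ) (hq : q ∈ T) (hq1 : q.2.1 = μ) (hq2 : q.2.2 < ν) :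
    ∃ W γ : ℝ, 0 ≤ γ ∧ W * μ + γ * ν ≤ l0 ∧ ∀ p ∈ T, p.1 ≤ W * p.2.1 + γ * p.2.2 := by
  set C : Set (ℝ × ℝ × ℝ) :=
    {z | ∃ p ∈ T, 0 < p.2.1 ∧ z.2.1 = p.2.1 ∧ z.1 < p.1 ∧ p.2.2 < z.2.2} with hC
  have hconv : Convex ℝ C := by
    rw [convex_iff_forall_pos]
    rintro x ⟨p, hp, hp0, h1, h2, h3⟩ y ⟨p', hp', hp0', h1', h2', h3'⟩ a b ha hb hab
    refine ⟨a • p + b • p', hadd _ (hsmul _ hp _ ha) _ (hsmul _ hp' _ hb), ?_, ?_, ?_, ?_⟩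
    · simp only [Prod.snd_add, Prod.fst_add, Prod.smul_snd, Prod.smul_fst, smul_eq_mul]
      positivity
    · simp only [Prod.snd_add, Prod.fst_add, Prod.smul_snd, Prod.smul_fst, smul_eq_mul, h1, h1']
    · simp only [Prod.snd_add, Prod.fst_add, Prod.smul_snd, Prod.smul_fst, smul_eq_mul]
      gcongr
    · simp only [Prod.snd_add, Prod.fst_add, Prod.smul_snd, Prod.smul_fst, smul_eq_mul]
      gcongr
  have hopen : IsOpen C := by
    have hCU : C = ⋃ p ∈ {p | p ∈ T ∧ 0 < p.2.1},
        ({z | 0 < z.2.1} ∩ ({z | z.1 < (z.2.1 / p.2.1) * p.1} ∩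
          {z | (z.2.1 / p.2.1) * p.2.2 < z.2.2}) : Set (ℝ × ℝ × ℝ)) := by
      ext z
      simp only [hC, Set.mem_ofPred_eq, Set.mem_iUnion, Set.mem_inter_iff, exists_prop]
      constructor
      · rintro ⟨p, hp, hp0, h1, h2, h3⟩
        refine ⟨p, ⟨hp, hp0⟩, h1 ▸ hp0, ?_, ?_⟩ <;> rw [h1, div_self hp0.ne', one_mul] <;> assumption
      · rintro ⟨p, ⟨hp, hp0⟩, h1, h2, h3⟩
        refine ⟨(z.2.1 / p.2.1) • p, hsmul _ hp _ (div_pos h1 hp0), ?_, ?_, h2, h3⟩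
        · simp only [Prod.smul_snd, Prod.smul_fst, smul_eq_mul]
          positivity
        · simp only [Prod.smul_snd, Prod.smul_fst, smul_eq_mul]
          field_simp
    rw [hCU]
    refine isOpen_biUnion fun p _ => ?_
    refine (isOpen_lt (by fun_prop) (by fun_prop)).inter
      ((isOpen_lt (by fun_prop) (by fun_prop)).inter (isOpen_lt (by fun_prop) (by fun_prop)))
  have hnot : ((l0, μ, ν) : ℝ × ℝ × ℝ) ∉ C := by
    rintro ⟨p, hp, _, h1, h2, h3⟩
    exact absurd (hmax p hp h1.symm h3) (not_le.2 h2)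
  obtain ⟨f, hf⟩ := geometric_hahn_banach_open_point hconv hopen hnot
  set α := f (1, 0, 0) with hα
  set β := f (0, 1, 0) with hβ
  set κ := f (0, 0, 1) with hκ
  have hfe : ∀ a b c : ℝ, f (a, b, c) = a * α + b * β + c * κ := by
    intro a b c
    have : ((a, b, c) : ℝ × ℝ × ℝ) = a • (1, 0, 0) + b • (0, 1, 0) + c • (0, 0, 1) := by
      simp
    rw [this, map_add, map_add, map_smul, map_smul, map_smul]
    simp [hα, hβ, hκ]
  have key : ∀ p ∈ T, 0 < p.2.1 → ∀ s > 0, ∀ t > 0,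
      (p.1 - s) * α + p.2.1 * β + (p.2.2 + t) * κ < l0 * α + μ * β + ν * κ := by
    intro p hp hp0 s hs t ht
    have := hf (p.1 - s, p.2.1, p.2.2 + t) ⟨p, hp, hp0, rfl, by simpa using hs, by simpa using ht⟩
    rwa [hfe, hfe] at this
  have hq0 : 0 < q.2.1 := hq1 ▸ hμ
  have aux : ∀ A B : ℝ, (∀ s > 0, A + s * B < 0) → B ≤ 0 := by
    intro A B hAB
    by_contra! hB
    have := hAB ((|A| + 1) / B) (by positivity)
    rw [div_mul_cancel₀ _ hB.ne'] at this
    linarith [neg_abs_le A]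
  have aux2 : ∀ A B : ℝ, (∀ s > 0, A + s * B < 0) → A ≤ 0 := by
    intro A B hAB
    by_contra! hA
    have := hAB (A / (|B| + 1)) (by positivity)
    have h2 : A / (|B| + 1) * B ≥ -A := by
      rw [div_mul_eq_mul_div, ge_iff_le, le_div_iff₀ (by positivity)]
      nlinarith [neg_abs_le B]
    linarith
  have hα0 : 0 ≤ α := by
    have := aux (q.1 * α + q.2.1 * β + (q.2.2 + 1) * κ - (l0 * α + μ * β + ν * κ)) (-α) (by
      intro s hs
      linarith [key q hq hq0 s hs 1 one_pos])
    linarith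
  have hκ0 : κ ≤ 0 := by
    exact aux ((q.1 - 1) * α + q.2.1 * β + (q.2.2) * κ - (l0 * α + μ * β + ν * κ)) κ (by
      intro s hs
      linarith [key q hq hq0 1 one_pos s hs])
  have hα1 : 0 < α := by
    refine lt_of_le_of_ne hα0 fun h0 => ?_
    have := key q hq hq0 1 one_pos ((ν - q.2.2) / 2) (by linarith)
    rw [← h0, hq1] at this
    nlinarith
  have key2 : ∀ p ∈ T, 0 < p.2.1 → 
      p.1 * α + p.2.1 * β + p.2.2 * κ ≤ l0 * α + μ * β + ν * κ := by
    intro p hp hp0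
    have := aux2 (p.1 * α + p.2.1 * β + p.2.2 * κ - (l0 * α + μ * β + ν * κ)) (κ - α) (by
      intro s hs
      linarith [key p hp hp0 s hs s hs])
    linarith
  have key3 : 0 ≤ l0 * α + μ * β + ν * κ := by
    have := aux2 (-(l0 * α + μ * β + ν * κ)) (q.1 * α + q.2.1 * β + q.2.2 * κ - 1) (by
      intro s hs
      have := key2 (s • q) (hsmul q hq s hs) (by simp; positivity)
      simp only [Prod.smul_snd, Prod.smul_fst, smul_eq_mul] at this
      linarith)
    linarith
  have key4 : ∀ p ∈ T, 0 < p.2.1 → p.1 * α + p.2.1 * β + p.2.2 * κ ≤ 0 := by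
    intro p hp hp0
    refine aux (-(l0 * α + μ * β + ν * κ) - 1) _ ?_
    intro s hs
    have := key2 (s • p) (hsmul p hp s hs) (by simp; positivity)
    simp only [Prod.smul_snd, Prod.smul_fst, smul_eq_mul] at this
    linarith
  have key5 : ∀ p ∈ T, p.1 * α + p.2.1 * β + p.2.2 * κ ≤ 0 := by
    intro p hp
    refine aux2 _ (q.1 * α + q.2.1 * β + q.2.2 * κ - 1) ?_
    intro s hs
    have := key4 (p + s • q) (hadd p hp _ (hsmul q hq s hs)) (by
      have := hnn p hp
      simp only [Prod.snd_add, Prod.fst_add, Prod.smul_snd, Prod.smul_fst, smul_eq_mul]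
      positivity)
    simp only [Prod.snd_add, Prod.fst_add, Prod.smul_snd, Prod.smul_fst, smul_eq_mul] at this
    linarith
  refine ⟨-β / α, -κ / α, div_nonneg (by linarith) hα0, ?_, ?_⟩
  · rw [div_mul_eq_mul_div, div_mul_eq_mul_div, ← add_div, div_le_iff₀ hα1]
    linarith
  · intro p hp
    rw [div_mul_eq_mul_div, div_mul_eq_mul_div, ← add_div, le_div_iff₀ hα1]
    linarith [key5 p hp]

/-! ### Kernel estimates -/

lemma aux_cosh (t : ℝ) : 1 + t ^ 2 / 2 ≤ Real.cosh t := by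
  have h1 : Real.cosh t = 1 + 2 * Real.sinh (t / 2) ^ 2 := by
    have h2 := Real.cosh_two_mul (t / 2)
    rw [mul_div_cancel₀ _ two_ne_zero] at h2
    rw [h2, Real.cosh_sq]
    ring
  have h3 : |t / 2| ≤ |Real.sinh (t / 2)| := by
    rw [Real.abs_sinh]
    exact Real.self_le_sinh_iff.2 (abs_nonneg _)
  have h4 := sq_le_sq.2 h3
  rw [h1]
  nlinarith

lemma aux_K0_le_fun (r : ℝ) (hr : 0 < r) (t : ℝ) :
    Real.exp (-(r * Real.cosh t)) ≤ Real.exp (-r) * Real.exp (-(r / 2) * t ^ 2) := by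
  rw [← Real.exp_add]
  apply Real.exp_le_exp.2
  nlinarith [aux_cosh t]

lemma aux_K0_int (r : ℝ) (hr : 0 < r) :
    IntegrableOn (fun t => Real.exp (-(r * Real.cosh t))) (Set.Ioi (0 : ℝ)) := by
  have h1 := ((integrable_exp_neg_mul_sq (half_pos hr)).const_mul (Real.exp (-r)))
  refine (h1.mono' (by fun_prop) (ae_of_all _ fun t => ?_)).integrableOn
  rw [Real.norm_of_nonneg (Real.exp_pos _).le]
  exact aux_K0_le_fun r hr t

lemma aux_K0_nonneg (r : ℝ) : 0 ≤ K0 r :=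
  integral_nonneg fun _ => (Real.exp_pos _).le

lemma aux_K0_bound (r : ℝ) (hr : 0 < r) : K0 r ≤ Real.exp (-r) * (√(π / (r / 2)) / 2) := by
  have h1 := ((integrable_exp_neg_mul_sq (half_pos hr)).const_mul (Real.exp (-r)))
  rw [← integral_gaussian_Ioi, ← integral_const_mul]
  exact setIntegral_mono (aux_K0_int r hr) h1.integrableOn (aux_K0_le_fun r hr)

lemma aux_K0_anti (r s : ℝ) (hr : 0 < r) (hrs : r ≤ s) : K0 s ≤ K0 r := by
  refine setIntegral_mono (aux_K0_int s (hr.trans_le hrs)) (aux_K0_int r hr) fun t => ?_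
  apply Real.exp_le_exp.2
  have := Real.cosh_pos t
  nlinarith

lemma aux_K0_meas : Measurable K0 := by
  have h : StronglyMeasurable (fun p : ℝ × ℝ => Real.exp (-(p.1 * Real.cosh p.2))) := by
    apply Continuous.stronglyMeasurable
    fun_prop
  exact (h.integral_prod_right' (ν := volume.restrict (Set.Ioi (0 : ℝ)))).measurable

lemma aux_rad_cont : Continuous rad := by
  unfold rad; fun_prop

lemma aux_K0sq_int : Integrable (fun z : ℝ × ℝ => (K0 (rad z)) ^ 2) := by
  have hm : Measurable (fun z : ℝ × ℝ => (K0 (rad z)) ^ 2) :=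
    (aux_K0_meas.comp aux_rad_cont.measurable).pow_const 2
  refine ⟨hm.aestronglyMeasurable, ?_⟩
  rw [hasFiniteIntegral_iff_ofReal (ae_of_all _ fun z => sq_nonneg _)]
  rw [← lintegral_comp_polarCoord_symm]
  have hb : ∀ p ∈ polarCoord.target, ENNReal.ofReal p.1 • ENNReal.ofReal
      ((K0 (rad (polarCoord.symm p))) ^ 2) ≤
      ENNReal.ofReal (π / 2 * Real.exp (-2 * p.1)) := by
    rintro ⟨r, θ⟩ hp
    simp only [polarCoord_target, Set.mem_prod, Set.mem_Ioi] at hp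
    have hr : 0 < r := hp.1
    have hrad : rad (polarCoord.symm (r, θ)) = r := by
      simp only [rad, polarCoord_symm_apply]
      rw [show (r * Real.cos θ) ^ 2 + (r * Real.sin θ) ^ 2
        = r ^ 2 * (Real.sin θ ^ 2 + Real.cos θ ^ 2) by ring, Real.sin_sq_add_cos_sq, mul_one,
        Real.sqrt_sq hr.le]
    rw [hrad, smul_eq_mul, ← ENNReal.ofReal_mul hr.le]
    apply ENNReal.ofReal_le_ofReal
    have h1 := aux_K0_bound r hr
    have h2 : K0 r ^ 2 ≤ (Real.exp (-r) * (√(π / (r / 2)) / 2)) ^ 2 :=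
      pow_le_pow_left₀ (aux_K0_nonneg r) h1 2
    have h3 : (Real.exp (-r) * (√(π / (r / 2)) / 2)) ^ 2
        = Real.exp (-2 * r) * (π / (2 * r)) := by
      rw [mul_pow, div_pow, Real.sq_sqrt (by positivity), ← Real.exp_nat_mul]
      have : ((2 : ℕ) : ℝ) * -r = -2 * r := by push_cast; ring
      rw [this]
      field_simp
    rw [h3] at h2
    calc r * K0 r ^ 2 ≤ r * (Real.exp (-2 * r) * (π / (2 * r))) := by gcongr
      _ = π / 2 * Real.exp (-2 * r) := by field_simp
  refine lt_of_le_of_lt (setLIntegral_mono' polarCoord.open_target.measurableSet hb) ?_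
  rw [polarCoord_target]
  have hi : IntegrableOn (fun p : ℝ × ℝ => π / 2 * Real.exp (-2 * p.1))
      (Set.Ioi (0 : ℝ) ×ˢ Set.Ioo (-π) π) := by
    have h1 : IntegrableOn (fun r : ℝ => π / 2 * Real.exp (-2 * r)) (Set.Ioi 0) :=
      (exp_neg_integrableOn_Ioi 0 two_pos).const_mul _
    have h2 : IntegrableOn (fun _ : ℝ => (1 : ℝ)) (Set.Ioo (-π) π) :=
      integrableOn_const (by simp)
    have h3 := Integrable.mul_prod h1 h2
    rw [Measure.prod_restrict] at h3
    simpa [IntegrableOn, Measure.volume_eq_prod] using h3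
  exact hi.lintegral_lt_top

/-! ### The operator -/

lemma aux_UHP_meas : MeasurableSet UHP := measurableSet_lt measurable_const measurable_snd

lemma aux_refl_rad (x y : ℝ × ℝ) : rad (reflPt x - y) = rad (reflPt y - x) := by
  simp only [rad, reflPt, Prod.fst_sub, Prod.snd_sub]
  congr 1; ring

lemma aux_rad_comm (x y : ℝ × ℝ) : rad (x - y) = rad (y - x) := by
  simp only [rad, Prod.fst_sub, Prod.snd_sub]
  congr 1; ring

lemma aux_GUHP_symm (x y : ℝ × ℝ) : GUHP x y = GUHP y x := by
  simp only [GUHP, Gker]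
  rw [aux_refl_rad x y, aux_rad_comm x y]

lemma aux_GUHP_meas2 : Measurable (Function.uncurry GUHP) := by
  have h1 : Measurable (fun p : (ℝ × ℝ) × (ℝ × ℝ) => K0 (rad (p.1 - p.2))) :=
    aux_K0_meas.comp (aux_rad_cont.comp (by fun_prop)).measurable
  have h2 : Measurable (fun p : (ℝ × ℝ) × (ℝ × ℝ) => K0 (rad (reflPt p.1 - p.2))) := by
    refine aux_K0_meas.comp (aux_rad_cont.comp ?_).measurable
    unfold reflPt
    fun_prop
  exact (h1.const_mul _).sub (h2.const_mul _)

lemma aux_GUHP_nonneg (x y : ℝ × ℝ) (hx : x ∈ UHP) (hy : y ∈ UHP) (hxy : x ≠ y) :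
    0 ≤ GUHP x y := by
  have hx' : 0 < x.2 := hx
  have hy' : 0 < y.2 := hy
  have hpos : 0 < rad (x - y) := by
    apply Real.sqrt_pos.2
    simp only [Prod.fst_sub, Prod.snd_sub]
    by_contra! hle
    apply hxy
    have h1 : x.1 - y.1 = 0 := by nlinarith [sq_nonneg (x.1 - y.1), sq_nonneg (x.2 - y.2)]
    have h2 : x.2 - y.2 = 0 := by nlinarith [sq_nonneg (x.1 - y.1), sq_nonneg (x.2 - y.2)]
    exact Prod.ext (by linarith) (by linarith)
  have hle : rad (x - y) ≤ rad (reflPt x - y) := by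
    apply Real.sqrt_le_sqrt
    simp only [Prod.fst_sub, Prod.snd_sub, reflPt]
    nlinarith [mul_pos hx' hy']
  have := aux_K0_anti _ _ hpos hle
  simp only [GUHP, Gker]
  rw [← mul_sub]
  have hpi := Real.pi_pos
  exact mul_nonneg (by positivity) (by linarith)

/-- Uniform bound for `∫ G_Π(x,y)² dy`. -/
noncomputable def auxD : ℝ := 4 * ((1 / (2 * Real.pi)) ^ 2 * ∫ z : ℝ × ℝ, (K0 (rad z)) ^ 2)

lemma aux_Gker_sq_int (x : ℝ × ℝ) : Integrable (fun y => (Gker x y) ^ 2) := by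
  have := (aux_K0sq_int.comp_sub_left x).const_mul ((1 / (2 * Real.pi)) ^ 2)
  refine this.congr (ae_of_all _ fun y => ?_)
  simp only [Gker]
  ring

lemma aux_Gker_sq_val (x : ℝ × ℝ) : ∫ y, (Gker x y) ^ 2 = auxD / 4 := by
  have h := integral_sub_left_eq_self (fun z : ℝ × ℝ => (K0 (rad z)) ^ 2) volume x
  simp only [Gker, mul_pow, auxD]
  rw [integral_const_mul, h]
  ring

lemma aux_GUHP_sq_le (x y : ℝ × ℝ) :
    GUHP x y ^ 2 ≤ 2 * Gker x y ^ 2 + 2 * Gker (reflPt x) y ^ 2 := by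
  simp only [GUHP]
  nlinarith [sq_nonneg (Gker x y + Gker (reflPt x) y)]

lemma aux_GUHP_meas_right (x : ℝ × ℝ) : Measurable (GUHP x) := by
  have h : Measurable (fun y : ℝ × ℝ => (x, y)) := measurable_prodMk_left
  have h2 := aux_GUHP_meas2.comp h
  exact h2

lemma aux_GUHP_sq_int (x : ℝ × ℝ) : Integrable (fun y => (GUHP x y) ^ 2) := by
  refine (((aux_Gker_sq_int x).const_mul 2).add ((aux_Gker_sq_int (reflPt x)).const_mul 2)).mono'
    ((aux_GUHP_meas_right x).pow_const 2).aestronglyMeasurable (ae_of_all _ fun y => ?_)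
  rw [Real.norm_of_nonneg (sq_nonneg _)]
  exact aux_GUHP_sq_le x y

lemma aux_GUHP_sq_val (x : ℝ × ℝ) : ∫ y in UHP, (GUHP x y) ^ 2 ≤ auxD := by
  calc ∫ y in UHP, (GUHP x y) ^ 2 ≤ ∫ y, (GUHP x y) ^ 2 :=
        setIntegral_le_integral (aux_GUHP_sq_int x) (ae_of_all _ fun y => sq_nonneg _)
    _ ≤ ∫ y, (2 * Gker x y ^ 2 + 2 * Gker (reflPt x) y ^ 2) :=
        integral_mono (aux_GUHP_sq_int x)
          (((aux_Gker_sq_int x).const_mul 2).add ((aux_Gker_sq_int (reflPt x)).const_mul 2))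
          (aux_GUHP_sq_le x)
    _ = auxD := by
        rw [integral_add ((aux_Gker_sq_int x).const_mul 2)
          ((aux_Gker_sq_int (reflPt x)).const_mul 2), integral_const_mul, integral_const_mul,
          aux_Gker_sq_val, aux_Gker_sq_val]
        ring

/-- `L¹ ∩ L²` on the half plane. -/
def AuxP (f : ℝ × ℝ → ℝ) : Prop :=
  IntegrableOn f UHP ∧ IntegrableOn (fun x => (f x) ^ 2) UHP

lemma aux_young (a b ε : ℝ) (hε : 0 < ε) : |a * b| ≤ 1 / (2 * ε) * a ^ 2 + ε / 2 * b ^ 2 := by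
  have h : 1 / (2 * ε) * a ^ 2 + ε / 2 * b ^ 2 = (|a| ^ 2 + (ε * |b|) ^ 2) / (2 * ε) := by
    rw [mul_pow, sq_abs, sq_abs]; field_simp
  rw [h, le_div_iff₀ (by positivity), abs_mul]
  nlinarith [sq_nonneg (|a| - ε * |b|)]

lemma aux_Gf_int (f : ℝ × ℝ → ℝ) (hf : AuxP f) (x : ℝ × ℝ) :
    IntegrableOn (fun y => GUHP x y * f y) UHP := by
  refine (((aux_GUHP_sq_int x).integrableOn.const_mul (1 / (2 * 1))).add
    (hf.2.const_mul (1 / 2))).mono'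
    ((aux_GUHP_meas_right x).aestronglyMeasurable.mul hf.1.1) (ae_of_all _ fun y => ?_)
  exact aux_young _ _ 1 one_pos

lemma aux_Gf_bound (f : ℝ × ℝ → ℝ) (hf : AuxP f) (ε : ℝ) (hε : 0 < ε) (x : ℝ × ℝ) :
    ∫ y in UHP, ‖GUHP x y * f y‖ ≤ 1 / (2 * ε) * auxD + ε / 2 * ∫ y in UHP, f y ^ 2 := by
  have h1 := Integrable.const_mul ((aux_GUHP_sq_int x).integrableOn (s := UHP)) (1 / (2 * ε))
  have h2 := hf.2.const_mul (ε / 2)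
  calc ∫ y in UHP, ‖GUHP x y * f y‖
      ≤ ∫ y in UHP, (1 / (2 * ε) * GUHP x y ^ 2 + ε / 2 * f y ^ 2) :=
        integral_mono (aux_Gf_int f hf x).norm (h1.add h2) fun y => aux_young _ _ ε hε
    _ = 1 / (2 * ε) * (∫ y in UHP, GUHP x y ^ 2) + ε / 2 * ∫ y in UHP, f y ^ 2 := by
        rw [integral_add h1 h2, integral_const_mul, integral_const_mul]
    _ ≤ _ := by
        have := aux_GUHP_sq_val x
        gcongr

lemma aux_Gop_bound (f : ℝ × ℝ → ℝ) (hf : AuxP f) (ε : ℝ) (hε : 0 < ε) (x : ℝ × ℝ) :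
    |Gop f x| ≤ 1 / (2 * ε) * auxD + ε / 2 * ∫ y in UHP, f y ^ 2 :=
  (norm_integral_le_integral_norm _).trans (aux_Gf_bound f hf ε hε x)

lemma aux_prod_int (f g : ℝ × ℝ → ℝ) (hf : AuxP f) (hg : AuxP g) :
    Integrable (fun p : (ℝ × ℝ) × (ℝ × ℝ) => f p.1 * (GUHP p.1 p.2 * g p.2))
      ((volume.restrict UHP).prod (volume.restrict UHP)) := by
  have hm : AEStronglyMeasurable
      (fun p : (ℝ × ℝ) × (ℝ × ℝ) => f p.1 * (GUHP p.1 p.2 * g p.2))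
      ((volume.restrict UHP).prod (volume.restrict UHP)) :=
    hf.1.1.comp_fst.mul (aux_GUHP_meas2.aestronglyMeasurable.mul hg.1.1.comp_snd)
  rw [integrable_prod_iff hm]
  refine ⟨ae_of_all _ fun x => (aux_Gf_int g hg x).const_mul (f x), ?_⟩
  refine (hf.1.norm.mul_const (1 / (2 * 1) * auxD + 1 / 2 * ∫ y in UHP, g y ^ 2)).mono'
    hm.norm.integral_prod_right' (ae_of_all _ fun x => ?_)
  rw [Real.norm_of_nonneg (integral_nonneg fun y => norm_nonneg _)]
  simp only [norm_mul (f x)]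
  rw [integral_const_mul]
  exact mul_le_mul_of_nonneg_left (aux_Gf_bound g hg 1 one_pos x) (norm_nonneg _)

lemma aux_fG_int (f g : ℝ × ℝ → ℝ) (hf : AuxP f) (hg : AuxP g) :
    IntegrableOn (fun x => f x * Gop g x) UHP := by
  have := (aux_prod_int f g hf hg).integral_prod_left
  refine this.congr (ae_of_all _ fun x => ?_)
  simp only [Gop]
  rw [integral_const_mul]

lemma aux_B_symm (f g : ℝ × ℝ → ℝ) (hf : AuxP f) (hg : AuxP g) :
    ∫ x in UHP, f x * Gop g x = ∫ x in UHP, g x * Gop f x := by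
  have := integral_integral_swap (f := fun x y => f x * (GUHP x y * g y))
    (aux_prod_int f g hf hg)
  simp only [Gop, ← integral_const_mul]
  rw [this]
  congr 1
  ext y
  congr 1
  ext x
  rw [aux_GUHP_symm]
  ring

lemma aux_Gop_meas (g : ℝ × ℝ → ℝ) (hg : AuxP g) :
    AEStronglyMeasurable (Gop g) (volume.restrict UHP) := by
  have hm : AEStronglyMeasurable
      (fun p : (ℝ × ℝ) × (ℝ × ℝ) => GUHP p.1 p.2 * g p.2)
      ((volume.restrict UHP).prod (volume.restrict UHP)) :=
    (aux_GUHP_meas2.aestronglyMeasurable.mul hg.1.1.comp_snd)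
  exact hm.integral_prod_right'

lemma aux_Gop_nonneg (g : ℝ × ℝ → ℝ) (hg : ∀ x ∈ UHP, 0 ≤ g x) (x : ℝ × ℝ) (hx : x ∈ UHP) :
    0 ≤ Gop g x := by
  apply integral_nonneg_of_ae
  have h1 : ∀ᵐ y ∂(volume.restrict UHP), y ≠ x := by
    apply ae_restrict_of_ae
    have : volume ({x} : Set (ℝ × ℝ)) = 0 := measure_singleton x
    filter_upwards [compl_mem_ae_iff.2 this] with y hy using hy
  filter_upwards [h1, ae_restrict_mem aux_UHP_meas] with y hy1 hy2
  exact mul_nonneg (aux_GUHP_nonneg x y hx hy2 (Ne.symm hy1)) (hg y hy2)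

lemma aux_mul_int (f g : ℝ × ℝ → ℝ) (hf : AuxP f) (hg : AuxP g) :
    IntegrableOn (fun x => f x * g x) UHP := by
  refine ((hf.2.const_mul (1 / (2 * 1))).add (hg.2.const_mul (1 / 2))).mono'
    (hf.1.1.mul hg.1.1) (ae_of_all _ fun y => ?_)
  exact aux_young _ _ 1 one_pos

lemma AuxP.comb {f g : ℝ × ℝ → ℝ} (hf : AuxP f) (hg : AuxP g) (a b : ℝ) :
    AuxP (fun x => a * f x + b * g x) := by
  refine ⟨(hf.1.const_mul a).add (hg.1.const_mul b), ?_⟩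
  have := ((hf.2.const_mul (a ^ 2)).add (hg.2.const_mul (b ^ 2))).add
    ((aux_mul_int f g hf hg).const_mul (2 * a * b))
  refine this.congr (ae_of_all _ fun x => ?_)
  simp only [Pi.add_apply]
  ring

/-- The bilinear form of the energy. -/
noncomputable def auxQ (lam : ℝ) (f g : ℝ × ℝ → ℝ) : ℝ :=
  (∫ x in UHP, f x * Gop g x) - 1 / lam * ∫ x in UHP, f x * g x

lemma aux_Efun_eq (lam : ℝ) (f : ℝ × ℝ → ℝ) : Efun lam f = 1 / 2 * auxQ lam f f := by
  simp only [Efun, kineticE, auxQ, sq]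
  ring

lemma aux_Q_symm (lam : ℝ) (f g : ℝ × ℝ → ℝ) (hf : AuxP f) (hg : AuxP g) :
    auxQ lam f g = auxQ lam g f := by
  simp only [auxQ]
  rw [aux_B_symm f g hf hg]
  simp only [mul_comm]

lemma aux_Q_comb (lam : ℝ) (f g k : ℝ × ℝ → ℝ) (hf : AuxP f) (hg : AuxP g) (hk : AuxP k)
    (a b : ℝ) : auxQ lam (fun x => a * f x + b * g x) k = a * auxQ lam f k + b * auxQ lam g k := by
  simp only [auxQ, add_mul, mul_assoc]
  rw [integral_add ((aux_fG_int f k hf hk).const_mul a) ((aux_fG_int g k hg hk).const_mul b),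
    integral_add ((aux_mul_int f k hf hk).const_mul a) ((aux_mul_int g k hg hk).const_mul b)]
  simp only [integral_const_mul]
  ring

lemma aux_Efun_bdd (lam μ ν : ℝ) (hlam : 1 < lam) (hν : 0 < ν) :
    BddAbove {s | ∃ ω, InAdm μ ν ω ∧ s = Efun lam ω} := by
  set ε := 2 / (lam * ν) with hεd
  have hl : 0 < lam := by linarith
  have hε : 0 < ε := by positivity
  refine ⟨1 / 2 * (ν * (1 / (2 * ε) * auxD)), ?_⟩
  rintro s ⟨ω, ⟨h0, h1, h2, -, -, h5⟩, rfl⟩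
  have hP : AuxP ω := ⟨h1, h2⟩
  set N := ∫ y in UHP, ω y ^ 2 with hN
  have hN0 : 0 ≤ N := integral_nonneg fun _ => sq_nonneg _
  have hb : ∫ x in UHP, ω x * Gop ω x ≤ ∫ x in UHP, ω x * (1 / (2 * ε) * auxD + ε / 2 * N) := by
    refine setIntegral_mono_on (aux_fG_int ω ω hP hP) (h1.mul_const _) aux_UHP_meas ?_
    intro x hx
    exact mul_le_mul_of_nonneg_left ((le_abs_self _).trans (aux_Gop_bound ω hP ε hε x)) (h0 x hx)
  rw [integral_mul_const] at hb
  have hD : 0 ≤ auxD := by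
    unfold auxD
    have := integral_nonneg (μ := volume) (f := fun z : ℝ × ℝ => (K0 (rad z)) ^ 2)
      fun _ => sq_nonneg _
    positivity
  have hc : (∫ x in UHP, ω x) * (1 / (2 * ε) * auxD + ε / 2 * N) ≤
      ν * (1 / (2 * ε) * auxD + ε / 2 * N) := by
    gcongr
  have he : ν * (ε / 2 * N) = 1 / lam * N := by
    rw [hεd]; field_simp
  have h2l : 1 / (2 * lam) * N = 1 / 2 * (1 / lam * N) := by field_simp
  simp only [Efun, kineticE]
  rw [← hN, h2l]
  linarith

lemma aux_first_order (lam μ ν : ℝ) (hlam : 1 < lam) (hν : 0 < ν) (ω ζ : ℝ × ℝ → ℝ)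
    (hω : IsMaximizer lam μ ν ω) (hζ : InAdm μ ν ζ) : auxQ lam ζ ω ≤ auxQ lam ω ω := by
  obtain ⟨hA, hmx⟩ := hω
  have hle : ∀ η, InAdm μ ν η → auxQ lam η η ≤ auxQ lam ω ω := by
    intro η hη
    have : Efun lam η ≤ Efun lam ω := by
      rw [hmx]
      exact le_csSup (aux_Efun_bdd lam μ ν hlam hν) ⟨η, hη, rfl⟩
    rw [aux_Efun_eq, aux_Efun_eq] at this
    linarith
  obtain ⟨w0, w1, w2, w3, w4, w5⟩ := hA
  obtain ⟨z0, z1, z2, z3, z4, z5⟩ := hζ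
  have hPw : AuxP ω := ⟨w1, w2⟩
  have hPz : AuxP ζ := ⟨z1, z2⟩
  have hq : ∀ t : ℝ, 0 < t → t < 1 →
      2 * (1 - t) * (auxQ lam ζ ω - auxQ lam ω ω) + t * (auxQ lam ζ ζ - auxQ lam ω ω) ≤ 0 := by
    intro t ht0 ht1
    have hP := hPw.comb hPz (1 - t) t
    have hadm : InAdm μ ν (fun x => (1 - t) * ω x + t * ζ x) := by
      have ht : 0 ≤ 1 - t := by linarith
      have he : ∀ x : ℝ × ℝ, x.2 * ((1 - t) * ω x + t * ζ x)
        = (1 - t) * (x.2 * ω x) + t * (x.2 * ζ x) := fun x => by ring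
      refine ⟨fun x hx => ?_, hP.1, hP.2, ?_, ?_, ?_⟩
      · have := w0 x hx
        have := z0 x hx
        positivity
      · simp only [he]
        exact (w3.const_mul _).add (z3.const_mul _)
      · simp only [impulse, he] at w4 z4 ⊢
        rw [integral_add (w3.const_mul _) (z3.const_mul _), integral_const_mul,
          integral_const_mul, w4, z4]
        ring
      · rw [integral_add (w1.const_mul _) (z1.const_mul _), integral_const_mul,
          integral_const_mul]
        nlinarith
    have h := hle _ hadm
    rw [aux_Q_comb lam ω ζ _ hPw hPz hP, aux_Q_symm lam ω _ hPw hP, aux_Q_symm lam ζ _ hPz hP,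
      aux_Q_comb lam ω ζ _ hPw hPz hPw, aux_Q_comb lam ω ζ _ hPw hPz hPz,
      aux_Q_symm lam ω ζ hPw hPz] at h
    have h2 : t * (2 * (1 - t) * (auxQ lam ζ ω - auxQ lam ω ω)
        + t * (auxQ lam ζ ζ - auxQ lam ω ω)) ≤ 0 := by linarith
    exact nonpos_of_mul_nonpos_right h2 ht0
  have hlim : Tendsto (fun t : ℝ => 2 * (1 - t) * (auxQ lam ζ ω - auxQ lam ω ω)
      + t * (auxQ lam ζ ζ - auxQ lam ω ω)) (𝓝[>] 0) (𝓝 (2 * (1 - 0) *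
      (auxQ lam ζ ω - auxQ lam ω ω) + 0 * (auxQ lam ζ ζ - auxQ lam ω ω))) :=
    tendsto_nhdsWithin_of_tendsto_nhds (Continuous.tendsto (by fun_prop) 0)
  have := le_of_tendsto hlim (by
    filter_upwards [Ioo_mem_nhdsGT (one_pos : (0 : ℝ) < 1)] with t ht using hq t ht.1 ht.2)
  linarith

/-- The cone of test functions. -/
def AuxK (f : ℝ × ℝ → ℝ) : Prop :=
  (∀ x ∈ UHP, 0 ≤ f x) ∧ AuxP f ∧ IntegrableOn (fun x => x.2 * f x) UHP

lemma AuxK.comb {f g : ℝ × ℝ → ℝ} (hf : AuxK f) (hg : AuxK g) (a b : ℝ) (ha : 0 ≤ a)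
    (hb : 0 ≤ b) : AuxK (fun x => a * f x + b * g x) := by
  refine ⟨fun x hx => ?_, hf.2.1.comb hg.2.1 a b, ?_⟩
  · have := hf.1 x hx
    have := hg.1 x hx
    positivity
  · refine ((hf.2.2.const_mul a).add (hg.2.2.const_mul b)).congr (ae_of_all _ fun x => ?_)
    simp only [Pi.add_apply]
    ring

lemma aux_impulse_comb {f g : ℝ × ℝ → ℝ} (hf : AuxK f) (hg : AuxK g) (a b : ℝ) :
    impulse (fun x => a * f x + b * g x) = a * impulse f + b * impulse g := by
  simp only [impulse]
  rw [← integral_const_mul, ← integral_const_mul,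
    ← integral_add (hf.2.2.const_mul a) (hg.2.2.const_mul b)]
  congr 1; ext x; ring

lemma aux_mass_comb {f g : ℝ × ℝ → ℝ} (hf : AuxK f) (hg : AuxK g) (a b : ℝ) :
    ∫ x in UHP, (a * f x + b * g x) = a * (∫ x in UHP, f x) + b * ∫ x in UHP, g x := by
  rw [← integral_const_mul, ← integral_const_mul,
    ← integral_add (hf.2.1.1.const_mul a) (hg.2.1.1.const_mul b)]

lemma aux_test (s : Set (ℝ × ℝ)) (hs : MeasurableSet s) (hs2 : volume.restrict UHP s < ⊤) :
    AuxK (s.indicator fun x => 1 / (1 + x.2)) := by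
  have hone : Integrable (s.indicator fun _ => (1 : ℝ)) (volume.restrict UHP) :=
    (integrable_indicator_iff hs).2 (integrableOn_const hs2.ne)
  have hm : Measurable (s.indicator fun x : ℝ × ℝ => 1 / (1 + x.2)) :=
    Measurable.indicator (by fun_prop) hs
  have hnn : ∀ x ∈ UHP, 0 ≤ s.indicator (fun x : ℝ × ℝ => 1 / (1 + x.2)) x := by
    intro x hx
    have hx' : 0 < x.2 := hx
    by_cases h : x ∈ s
    · simp only [h, Set.indicator_of_mem]; positivity
    · simp [h]
  have hle : ∀ x ∈ UHP, s.indicator (fun x : ℝ × ℝ => 1 / (1 + x.2)) x ≤ 1 ∧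
      x.2 * s.indicator (fun x : ℝ × ℝ => 1 / (1 + x.2)) x ≤ 1 := by
    intro x hx
    have hx' : 0 < x.2 := hx
    by_cases h : x ∈ s
    · simp only [h, Set.indicator_of_mem]
      constructor
      · rw [div_le_one (by positivity)]; linarith
      · rw [mul_one_div, div_le_one (by positivity)]; linarith
    · simp [h]
  have hdom : ∀ F : ℝ × ℝ → ℝ, Measurable F → (∀ x ∈ UHP, |F x| ≤ 1) →
      (∀ x ∉ s, F x = 0) → IntegrableOn F UHP := by
    intro F hF h1 h2
    refine hone.mono' hF.aestronglyMeasurable ?_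
    filter_upwards [ae_restrict_mem aux_UHP_meas] with x hx
    by_cases h : x ∈ s
    · simpa [h] using h1 x hx
    · simp [h, h2 x h]
  refine ⟨hnn, ⟨hdom _ hm ?_ ?_, hdom _ (hm.pow_const 2) ?_ ?_⟩,
    hdom _ (measurable_snd.mul hm) ?_ ?_⟩
  · intro x hx
    rw [abs_of_nonneg (hnn x hx)]
    exact (hle x hx).1
  · intro x hx
    simp [hx]
  · intro x hx
    rw [abs_of_nonneg (sq_nonneg _)]
    exact pow_le_one₀ (hnn x hx) (hle x hx).1
  · intro x hx
    simp [hx]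
  · intro x hx
    have hx' : 0 < x.2 := hx
    rw [abs_of_nonneg (mul_nonneg hx'.le (hnn x hx))]
    exact (hle x hx).2
  · intro x hx
    simp [hx]

lemma aux_slater (μ ν : ℝ) (hμ : 0 < μ) (hν : 0 < ν) :
    ∃ ζ, AuxK ζ ∧ impulse ζ = μ ∧ ∫ x in UHP, ζ x < ν := by
  set R := μ / ν + 1 with hR
  have hR0 : 0 < R := by positivity
  set s : Set (ℝ × ℝ) := Set.Icc 0 1 ×ˢ Set.Icc R (R + 1) with hs
  have hsm : MeasurableSet s := measurableSet_Icc.prod measurableSet_Icc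
  have hsU : s ⊆ UHP := fun x hx => lt_of_lt_of_le hR0 hx.2.1
  have hvol : volume s = 1 := by
    rw [hs, Measure.volume_eq_prod, Measure.prod_prod]
    simp
  have hres : volume.restrict UHP s = 1 := by
    rw [Measure.restrict_apply hsm, Set.inter_eq_left.2 hsU, hvol]
  have hK := aux_test s hsm (by rw [hres]; exact ENNReal.one_lt_top)
  set ζ : ℝ × ℝ → ℝ := s.indicator fun x => 1 / (1 + x.2) with hζ
  have hM : 0 < ∫ x in UHP, ζ x := by
    have h0 : 0 ≤ᵐ[volume.restrict UHP] ζ := by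
      filter_upwards [ae_restrict_mem aux_UHP_meas] with x hx using hK.1 x hx
    rw [integral_pos_iff_support_of_nonneg_ae h0 hK.2.1.1]
    have : s ⊆ Function.support ζ := by
      intro x hx
      have hx' : 0 < x.2 := hsU hx
      rw [Function.mem_support, hζ, Set.indicator_of_mem hx]
      positivity
    refine lt_of_lt_of_le ?_ (measure_mono this)
    rw [hres]; exact one_pos
  have hI : R * (∫ x in UHP, ζ x) ≤ impulse ζ := by
    rw [← integral_const_mul]
    refine integral_mono (hK.2.1.1.const_mul R) hK.2.2 fun x => ?_
    by_cases h : x ∈ s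
    · exact mul_le_mul_of_nonneg_right h.2.1 (hK.1 x (hsU h))
    · simp [hζ, h]
  have hI0 : 0 < impulse ζ := lt_of_lt_of_le (by positivity) hI
  refine ⟨fun x => (μ / impulse ζ) * ζ x + 0 * ζ x, hK.comb hK _ _ (by positivity) le_rfl, ?_, ?_⟩
  · rw [aux_impulse_comb hK hK]
    field_simp
    ring
  · rw [aux_mass_comb hK hK, zero_mul, add_zero, div_mul_eq_mul_div, div_lt_iff₀ hI0]
    calc μ * ∫ x in UHP, ζ x < (ν * R) * ∫ x in UHP, ζ x := by
          have : ν * R = μ + ν := by rw [hR]; field_simp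
          rw [this]
          nlinarith
      _ = ν * (R * ∫ x in UHP, ζ x) := by ring
      _ ≤ _ := by gcongr

lemma aux_line_null (a b : ℝ) (hab : a ≠ 0 ∨ b ≠ 0) :
    ∀ᵐ x ∂(volume.restrict UHP), a * x.2 + b ≠ 0 := by
  apply ae_restrict_of_ae
  by_cases ha : a = 0
  · subst ha
    refine ae_of_all _ fun x => ?_
    simpa using hab
  · have h0 : volume ((Set.univ : Set ℝ) ×ˢ ({-b / a} : Set ℝ)) = 0 := by
      rw [Measure.volume_eq_prod, Measure.prod_prod]
      simp
    filter_upwards [compl_mem_ae_iff.2 h0] with x hx hx2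
    apply hx
    refine ⟨trivial, ?_⟩
    rw [Set.mem_singleton_iff, eq_div_iff ha]
    linarith

lemma aux_not_zero (μ : ℝ) (hμ : 0 < μ) (ω : ℝ × ℝ → ℝ) (hI : impulse ω = μ)
    (h : ∀ᵐ x ∂(volume.restrict UHP), ω x = 0) : False := by
  have : impulse ω = 0 := by
    unfold impulse
    apply integral_eq_zero_of_ae
    filter_upwards [h] with x hx
    simp [hx]
  linarith

lemma aux_exists (lam μ ν : ℝ) (hlam : 1 < lam) (hμ : 0 < μ) (hν : 0 < ν)
    (ω : ℝ × ℝ → ℝ) (hω : IsMaximizer lam μ ν ω) :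
    ∃ W γ : ℝ, 0 ≤ γ ∧
      ∀ᵐ x ∂(volume.restrict UHP), ω x = lam * max (Gop ω x - W * x.2 - γ) 0 := by
  have hl : 0 < lam := by linarith
  obtain ⟨w0, w1, w2, w3, w4, w5⟩ := hω.1
  have hPw : AuxP ω := ⟨w1, w2⟩
  have hKw : AuxK ω := ⟨w0, hPw, w3⟩
  set T : Set (ℝ × ℝ × ℝ) :=
    {p | ∃ ζ, AuxK ζ ∧ p = (auxQ lam ζ ω, impulse ζ, ∫ x in UHP, ζ x)} with hT
  obtain ⟨ζ0, hζ0, hζ1, hζ2⟩ := aux_slater μ ν hμ hν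
  obtain ⟨W, γ, hγ, hl0, hall⟩ := aux_multiplier T (by
      rintro p ⟨f, hf, rfl⟩ q ⟨g, hg, rfl⟩
      refine ⟨_, hf.comb hg 1 1 zero_le_one zero_le_one, ?_⟩
      rw [aux_impulse_comb hf hg, aux_mass_comb hf hg, aux_Q_comb lam f g ω hf.2.1 hg.2.1 hPw]
      simp) (by
      rintro p ⟨f, hf, rfl⟩ s hs
      refine ⟨_, hf.comb hf s 0 hs.le le_rfl, ?_⟩
      rw [aux_impulse_comb hf hf, aux_mass_comb hf hf, aux_Q_comb lam f f ω hf.2.1 hf.2.1 hPw]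
      simp) (by
      rintro p ⟨f, hf, rfl⟩
      refine setIntegral_nonneg aux_UHP_meas fun x hx => ?_
      have hx' : 0 < x.2 := hx
      exact mul_nonneg hx'.le (hf.1 x hx))
    (auxQ lam ω ω) μ ν hμ (by
      rintro p ⟨f, hf, rfl⟩ h1 h2
      exact aux_first_order lam μ ν hlam hν ω f hω
        ⟨hf.1, hf.2.1.1, hf.2.1.2, hf.2.2, h1, le_of_lt h2⟩)
    (auxQ lam ζ0 ω, impulse ζ0, ∫ x in UHP, ζ0 x) ⟨ζ0, hζ0, rfl⟩ hζ1 hζ2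
  refine ⟨W, γ, hγ, ?_⟩
  -- pairing with a test function
  have hpi : ∀ ζ, AuxK ζ → Integrable (fun x => (W * x.2 + γ - (Gop ω x - 1 / lam * ω x)) * ζ x)
      (volume.restrict UHP) ∧
      ∫ x in UHP, (W * x.2 + γ - (Gop ω x - 1 / lam * ω x)) * ζ x
        = W * impulse ζ + γ * (∫ x in UHP, ζ x) - auxQ lam ζ ω := by
    intro ζ hζ
    have e : (fun x : ℝ × ℝ => (W * x.2 + γ - (Gop ω x - 1 / lam * ω x)) * ζ x) =
        fun x => (W * (x.2 * ζ x) + γ * ζ x) - (ζ x * Gop ω x - 1 / lam * (ζ x * ω x)) := by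
      ext x; ring
    have i1 := hζ.2.2.const_mul W
    have i2 := hζ.2.1.1.const_mul γ
    have i3 := aux_fG_int ζ ω hζ.2.1 hPw
    have i4 := (aux_mul_int ζ ω hζ.2.1 hPw).const_mul (1 / lam)
    rw [e]
    refine ⟨(i1.add i2).sub (i3.sub i4), ?_⟩
    have e1 := integral_sub (i1.add i2) (i3.sub i4)
    simp only [Pi.add_apply, Pi.sub_apply] at e1
    rw [e1, integral_add i1 i2, integral_sub i3 i4]
    simp only [integral_const_mul, auxQ, impulse]
  have hpos : 0 ≤ᵐ[volume.restrict UHP]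
      fun x => (W * x.2 + γ - (Gop ω x - 1 / lam * ω x)) * (1 / (1 + x.2)) := by
    have e : ∀ s : Set (ℝ × ℝ), (fun x : ℝ × ℝ => (W * x.2 + γ - (Gop ω x - 1 / lam * ω x)) *
        s.indicator (fun x => 1 / (1 + x.2)) x) = s.indicator
        fun x => (W * x.2 + γ - (Gop ω x - 1 / lam * ω x)) * (1 / (1 + x.2)) := by
      intro s
      ext x
      by_cases h : x ∈ s <;> simp [h]
    refine ae_nonneg_of_forall_setIntegral_nonneg_of_sigmaFinite ?_ ?_
    · intro s hs hs2
      have := (hpi _ (aux_test s hs hs2)).1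
      rw [e s] at this
      exact (integrable_indicator_iff hs).1 this
    · intro s hs hs2
      have h1 := (hpi _ (aux_test s hs hs2)).2
      rw [e s, integral_indicator hs] at h1
      rw [h1]
      have := hall _ ⟨_, aux_test s hs hs2, rfl⟩
      simp only at this
      linarith
  have hpos2 : ∀ᵐ x ∂(volume.restrict UHP), 0 ≤ W * x.2 + γ - (Gop ω x - 1 / lam * ω x) := by
    filter_upwards [hpos, ae_restrict_mem aux_UHP_meas] with x hx hxU
    have hx' : 0 < x.2 := hxU
    exact nonneg_of_mul_nonneg_left hx (by positivity)
  have hzero : ∀ᵐ x ∂(volume.restrict UHP),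
      (W * x.2 + γ - (Gop ω x - 1 / lam * ω x)) * ω x = 0 := by
    obtain ⟨h1, h2⟩ := hpi ω hKw
    have hnn : 0 ≤ᵐ[volume.restrict UHP]
        fun x => (W * x.2 + γ - (Gop ω x - 1 / lam * ω x)) * ω x := by
      filter_upwards [hpos2, ae_restrict_mem aux_UHP_meas] with x hx hxU
      exact mul_nonneg hx (w0 x hxU)
    have hz : ∫ x in UHP, (W * x.2 + γ - (Gop ω x - 1 / lam * ω x)) * ω x = 0 := by
      apply le_antisymm _ (integral_nonneg_of_ae hnn)
      rw [h2, w4]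
      nlinarith
    exact (integral_eq_zero_iff_of_nonneg_ae hnn h1).1 hz
  filter_upwards [hpos2, hzero, ae_restrict_mem aux_UHP_meas] with x h1 h2 hxU
  rcases mul_eq_zero.1 h2 with h3 | h3
  · have h4 : Gop ω x - W * x.2 - γ = 1 / lam * ω x := by linarith
    have h5 := w0 x hxU
    rw [h4, max_eq_left (by positivity)]
    field_simp
  · rw [h3] at h1 ⊢
    rw [max_eq_right (by linarith), mul_zero]

lemma aux_W_nonneg (lam : ℝ) (hlam : 1 < lam) (ω : ℝ × ℝ → ℝ) (h0 : ∀ x ∈ UHP, 0 ≤ ω x)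
    (hint : IntegrableOn ω UHP) (W γ : ℝ) (hγ : 0 ≤ γ)
    (h : ∀ᵐ x ∂(volume.restrict UHP), ω x = lam * max (Gop ω x - W * x.2 - γ) 0) : 0 ≤ W := by
  by_contra! hW
  set R := (γ + 1) / (-W) with hR
  have hW' : 0 < -W := by linarith
  have hR0 : 0 < R := by positivity
  have hfin := hint.measure_norm_ge_lt_top (one_pos : (0 : ℝ) < 1)
  have hsub : (Set.univ ×ˢ Set.Ioi R : Set (ℝ × ℝ)) ≤ᵐ[volume.restrict UHP]
      {x : ℝ × ℝ | 1 ≤ ‖ω x‖} := by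
    filter_upwards [h, ae_restrict_mem aux_UHP_meas] with x hx hxU hxs
    have hx2 : R < x.2 := hxs.2
    have hG := aux_Gop_nonneg ω h0 x hxU
    have h1 : γ + 1 < x.2 * (-W) := by
      rwa [hR, div_lt_iff₀ hW'] at hx2
    have h2 : 1 ≤ max (Gop ω x - W * x.2 - γ) 0 := le_max_of_le_left (by linarith)
    have h3 : 1 ≤ ω x := by
      rw [hx]
      nlinarith
    exact h3.trans (le_abs_self _)
  have hlt := (measure_mono_ae hsub).trans_lt hfin
  have hms : MeasurableSet (Set.univ ×ˢ Set.Ioi R : Set (ℝ × ℝ)) :=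
    MeasurableSet.univ.prod measurableSet_Ioi
  have hsU : (Set.univ ×ˢ Set.Ioi R : Set (ℝ × ℝ)) ⊆ UHP := fun x hx => hR0.trans hx.2
  rw [Measure.restrict_apply hms, Set.inter_eq_left.2 hsU, Measure.volume_eq_prod,
    Measure.prod_prod] at hlt
  simp at hlt

/-- Euler–Lagrange relation `ω = λ(𝒢ω − W x₂ − γ)₊` with `W, γ ≥ 0`
uniquely determined by `ω`. -/
theorem stmt8 (lam μ ν : ℝ) (hlam : 1 < lam) (hμ : 0 < μ) (hν : 0 < ν)
    (h : μ * varrho lam ≤ ν) (ω : ℝ × ℝ → ℝ) (hω : IsMaximizer lam μ ν ω) :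
    ∃! p : ℝ × ℝ, 0 ≤ p.1 ∧ 0 ≤ p.2 ∧
      ∀ᵐ x ∂(volume.restrict UHP), ω x = lam * max (Gop ω x - p.1 * x.2 - p.2) 0 := by
  obtain ⟨W, γ, hγ, hEL⟩ := aux_exists lam μ ν hlam hμ hν ω hω
  obtain ⟨w0, w1, w2, w3, w4, w5⟩ := hω.1
  refine ⟨(W, γ), ⟨aux_W_nonneg lam hlam ω w0 w1 W γ hγ hEL, hγ, hEL⟩, ?_⟩
  rintro ⟨W', γ'⟩ ⟨-, -, hEL'⟩
  simp only at hEL'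
  by_contra hne
  have hab : W' - W ≠ 0 ∨ γ' - γ ≠ 0 := by
    by_contra! hc
    exact hne (Prod.ext (by simpa using sub_eq_zero.1 hc.1) (by simpa using sub_eq_zero.1 hc.2))
  refine aux_not_zero μ hμ ω w4 ?_
  filter_upwards [hEL, hEL', aux_line_null _ _ hab] with x h1 h2 h3
  by_contra hx
  have hl : lam ≠ 0 := by linarith
  have aux : ∀ A : ℝ, ω x = lam * max A 0 → ω x = lam * A := by
    intro A hA
    rcases le_total A 0 with hA0 | hA0
    · rw [max_eq_right hA0, mul_zero] at hA
      exact absurd hA hx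
    · rwa [max_eq_left hA0] at hA
  have h4 := mul_left_cancel₀ hl ((aux _ h1).symm.trans (aux _ h2))
  apply h3
  linarith
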